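/- arXiv:1610.00158 — 4 statements merged into one kernel-verified Lean document; each statement's English description precedes it below -/
import Mathlib

section
/- Let p be a prime and n ≥ 1. The shearing map from W(𝔽_{p^n}) ⊗_{ℤ_p} W(𝔽_{p^n}) to the ring of functions from Gal(𝔽_{p^n}/𝔽_p) to W(𝔽_{p^n}), which sends an elementary tensor a ⊗ b to the function g ↦ a · g(b) (where g acts on Witt vectors by functoriality), is a bijection. -/
/-!
The shearing map `W(𝔽_{p^n}) ⊗_{ℤ_p} W(𝔽_{p^n}) → map(Gal(𝔽_{p^n}/𝔽_p), W(𝔽_{p^n}))`,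
sending `a ⊗ b` to the function `g ↦ a * g(b)` (where `g` acts on Witt vectors by
functoriality), is a bijection.  Here `ℤ_p = W(𝔽_p)`.
-/

open TensorProduct

variable (p : ℕ) [Fact p.Prime] (n : ℕ)

/-- `W(𝔽_{p^n})` is an algebra over `ℤ_p = W(𝔽_p)` via Witt vector functoriality. -/
noncomputable instance wittGaloisAlgebra :
    Algebra (WittVector p (ZMod p)) (WittVector p (GaloisField p n)) :=
  (WittVector.map (algebraMap (ZMod p) (GaloisField p n))).toAlgebra

lemma wittMap_algebraMap (g : GaloisField p n ≃ₐ[ZMod p] GaloisField p n)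
    (c : WittVector p (ZMod p)) :
    WittVector.map g.toRingEquiv.toRingHom
        (algebraMap (WittVector p (ZMod p)) (WittVector p (GaloisField p n)) c) =
      algebraMap (WittVector p (ZMod p)) (WittVector p (GaloisField p n)) c := by
  ext k
  simp only [RingHom.algebraMap_toAlgebra, WittVector.map_coeff]
  exact g.commutes (c.coeff k)

lemma wittMap_smul (g : GaloisField p n ≃ₐ[ZMod p] GaloisField p n)
    (c : WittVector p (ZMod p)) (b : WittVector p (GaloisField p n)) :
    WittVector.map g.toRingEquiv.toRingHom (c • b) =
      c • WittVector.map g.toRingEquiv.toRingHom b := by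
  rw [Algebra.smul_def, Algebra.smul_def, map_mul, wittMap_algebraMap]

/-- The bilinear shearing pairing `(a, b) ↦ (g ↦ a * g(b))`. -/
noncomputable def shearBilinear :
    WittVector p (GaloisField p n) →ₗ[WittVector p (ZMod p)]
      WittVector p (GaloisField p n) →ₗ[WittVector p (ZMod p)]
        ((GaloisField p n ≃ₐ[ZMod p] GaloisField p n) → WittVector p (GaloisField p n)) :=
  LinearMap.mk₂ (WittVector p (ZMod p))
    (fun a b g => a * WittVector.map g.toRingEquiv.toRingHom b)
    (fun a a' b => by funext g; simp [add_mul])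
    (fun c a b => by funext g; simp [smul_mul_assoc])
    (fun a b b' => by funext g; simp [mul_add])
    (fun c a b => by
      funext g
      simp only [Pi.smul_apply]
      rw [wittMap_smul, mul_smul_comm])

/-- The shearing map `a ⊗ b ↦ (g ↦ a * g(b))`. -/
noncomputable def shearingMap :
    (WittVector p (GaloisField p n) ⊗[WittVector p (ZMod p)] WittVector p (GaloisField p n))
      →ₗ[WittVector p (ZMod p)]
        ((GaloisField p n ≃ₐ[ZMod p] GaloisField p n) → WittVector p (GaloisField p n)) :=
  TensorProduct.lift (shearBilinear p n)

/-- An automorphism of `𝔽_{p^n}` acting on `W(𝔽_{p^n})`. -/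
noncomputable def wittGalois (g : GaloisField p n ≃ₐ[ZMod p] GaloisField p n) :
    WittVector p (GaloisField p n) →+* WittVector p (GaloisField p n) :=
  WittVector.map g.toRingEquiv.toRingHom

lemma wittGalois_coeff (g : GaloisField p n ≃ₐ[ZMod p] GaloisField p n)
    (x : WittVector p (GaloisField p n)) (k : ℕ) :
    (wittGalois p n g x).coeff k = g (x.coeff k) :=
  rfl

lemma wittGalois_mul (g h : GaloisField p n ≃ₐ[ZMod p] GaloisField p n)
    (x : WittVector p (GaloisField p n)) :
    wittGalois p n (g * h) x = wittGalois p n g (wittGalois p n h x) := by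
  ext k
  simp [wittGalois_coeff]

lemma wittGalois_algebraMap (g : GaloisField p n ≃ₐ[ZMod p] GaloisField p n)
    (c : WittVector p (ZMod p)) :
    wittGalois p n g (algebraMap _ _ c) =
      algebraMap (WittVector p (ZMod p)) (WittVector p (GaloisField p n)) c :=
  wittMap_algebraMap p n g c

lemma shearingMap_tmul (a b : WittVector p (GaloisField p n))
    (g : GaloisField p n ≃ₐ[ZMod p] GaloisField p n) :
    shearingMap p n (a ⊗ₜ b) g = a * wittGalois p n g b :=
  rfl

lemma wittGaloisAlgebra_algebraMap_injective :
    Function.Injective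
      (algebraMap (WittVector p (ZMod p)) (WittVector p (GaloisField p n))) :=
  WittVector.map_injective _ (algebraMap (ZMod p) (GaloisField p n)).injective

/-- Galois descent for Witt vectors: the Galois-fixed elements come from `W(𝔽_p)`. -/
lemma exists_algebraMap_eq_of_wittGalois_fixed {x : WittVector p (GaloisField p n)}
    (hx : ∀ g, wittGalois p n g x = x) :
    ∃ c : WittVector p (ZMod p),
      algebraMap (WittVector p (ZMod p)) (WittVector p (GaloisField p n)) c = x := by
  have h (k : ℕ) : x.coeff k ∈ Set.range (algebraMap (ZMod p) (GaloisField p n)) := by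
    rw [IsGalois.mem_range_algebraMap_iff_fixed]
    intro g
    rw [← wittGalois_coeff, hx]
  choose c hc using h
  refine ⟨WittVector.mk p c, ?_⟩
  ext k
  simp [RingHom.algebraMap_toAlgebra, WittVector.map_coeff, hc]

/-- The matrix of Galois conjugates of a family in `W(𝔽_{p^n})`. -/
noncomputable def conjMatrix {ι : Type*} (B : ι → WittVector p (GaloisField p n)) :
    Matrix (GaloisField p n ≃ₐ[ZMod p] GaloisField p n) ι (WittVector p (GaloisField p n)) :=
  Matrix.of fun g i => wittGalois p n g (B i)

lemma det_conj_ne_zero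
    [DecidableEq (GaloisField p n ≃ₐ[ZMod p] GaloisField p n)]
    (b : Module.Basis (GaloisField p n ≃ₐ[ZMod p] GaloisField p n) (ZMod p)
      (GaloisField p n)) :
    (Matrix.of fun g i : GaloisField p n ≃ₐ[ZMod p] GaloisField p n => g (b i)).det ≠ 0 := by
  rw [Ne, ← Matrix.exists_vecMul_eq_zero_iff]
  rintro ⟨v, hv, h⟩
  have hli := (linearIndependent_algHom_toLinearMap (ZMod p) (GaloisField p n)
    (GaloisField p n)).comp _ (AlgEquiv.coe_toAlgHom_injective (R := ZMod p)
      (A₁ := GaloisField p n) (A₂ := GaloisField p n))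
  refine hv (funext (Fintype.linearIndependent_iff.1 hli v (b.ext fun i => ?_)))
  simpa [Matrix.vecMul, dotProduct] using congrFun h i

lemma isUnit_conjMatrix
    [DecidableEq (GaloisField p n ≃ₐ[ZMod p] GaloisField p n)]
    (b : Module.Basis (GaloisField p n ≃ₐ[ZMod p] GaloisField p n) (ZMod p)
      (GaloisField p n)) {B : _ → WittVector p (GaloisField p n)}
    (hB : ∀ i, (B i).coeff 0 = b i) :
    IsUnit (conjMatrix p n B) := by
  rw [Matrix.isUnit_iff_isUnit_det]
  apply WittVector.isUnit_of_coeff_zero_ne_zero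
  change WittVector.constantCoeff (conjMatrix p n B).det ≠ 0
  rw [RingHom.map_det]
  convert det_conj_ne_zero p n b
  ext g i
  change (wittGalois p n g (B i)).coeff 0 = g (b i)
  rw [wittGalois_coeff, hB]

/-- A family whose matrix of conjugates is invertible is a basis over `W(𝔽_p)`. -/
noncomputable def basisOfIsUnitConjMatrix
    [DecidableEq (GaloisField p n ≃ₐ[ZMod p] GaloisField p n)]
    {B : (GaloisField p n ≃ₐ[ZMod p] GaloisField p n) → WittVector p (GaloisField p n)}
    (hB : IsUnit (conjMatrix p n B)) :
    Module.Basis (GaloisField p n ≃ₐ[ZMod p] GaloisField p n) (WittVector p (ZMod p))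
      (WittVector p (GaloisField p n)) := by
  refine .mk (v := B) (Fintype.linearIndependent_iff.2 fun c hc => ?_) fun x _ => ?_
  · have h : (conjMatrix p n B).mulVec (fun i => algebraMap _ _ (c i)) = 0 := by
      ext1 g
      have := congrArg (wittGalois p n g) hc
      simpa [wittGalois_algebraMap, Algebra.smul_def, conjMatrix, Matrix.mulVec, dotProduct,
        mul_comm] using this
    have h0 := Matrix.mulVec_injective_of_isUnit hB (h.trans (Matrix.mulVec_zero _).symm)
    intro i
    apply wittGaloisAlgebra_algebraMap_injective p n
    simpa using congrFun h0 i
  · obtain ⟨c, hc⟩ := Matrix.mulVec_surjective_iff_isUnit.2 hB (fun g => wittGalois p n g x)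
    have hc' (g) : ∑ i, wittGalois p n g (B i) * c i = wittGalois p n g x := congrFun hc g
    have hfix (h) : (fun i => wittGalois p n h (c i)) = c := by
      apply Matrix.mulVec_injective_of_isUnit hB
      rw [hc]
      ext1 g
      have := congrArg (wittGalois p n h) (hc' (h⁻¹ * g))
      simpa [← wittGalois_mul, conjMatrix, Matrix.mulVec, dotProduct] using this
    choose d hd using fun i =>
      exists_algebraMap_eq_of_wittGalois_fixed p n fun g => congrFun (hfix g) i
    have hx : x = ∑ i, d i • B i := by
      have h1 (y) : wittGalois p n 1 y = y := by ext k; rfl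
      simpa [h1, Algebra.smul_def, hd, mul_comm] using (hc' 1).symm
    rw [hx]
    exact Submodule.sum_mem _ fun i _ =>
      Submodule.smul_mem _ _ (Submodule.subset_span ⟨i, rfl⟩)

lemma shearingMap_eq_mulVec {ι : Type*} [Fintype ι]
    (B : Module.Basis ι (WittVector p (ZMod p)) (WittVector p (GaloisField p n)))
    (x : WittVector p (GaloisField p n) ⊗[WittVector p (ZMod p)]
      WittVector p (GaloisField p n)) :
    shearingMap p n x = (conjMatrix p n B).mulVec
      ((Algebra.TensorProduct.basis (WittVector p (GaloisField p n)) B).equivFun x) := by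
  induction x with
  | zero => simp
  | add x y hx hy => rw [map_add, map_add, hx, hy, Matrix.mulVec_add]
  | tmul a y =>
    ext1 g
    rw [shearingMap_tmul]
    conv_lhs => rw [← B.sum_repr y]
    simp only [map_sum, map_mul, wittGalois_algebraMap, Matrix.mulVec, dotProduct, conjMatrix, Matrix.of_apply,
      Finset.mul_sum, Module.Basis.equivFun_apply, Algebra.TensorProduct.basis_repr_tmul,
      Finsupp.smul_apply, Finsupp.mapRange_apply, smul_eq_mul, Algebra.smul_def]
    exact Finset.sum_congr rfl fun i _ => by ring

/-- The shearing map is a bijection. -/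
theorem shearingMap_bijective (hn : 1 ≤ n) :
    Function.Bijective (shearingMap p n) := by
  classical
  have hcard : Fintype.card (Fin (Module.finrank (ZMod p) (GaloisField p n))) =
      Fintype.card (GaloisField p n ≃ₐ[ZMod p] GaloisField p n) := by
    rw [Fintype.card_fin, ← IsGalois.card_aut_eq_finrank, Nat.card_eq_fintype_card]
  let b := (Module.finBasis (ZMod p) (GaloisField p n)).reindex (Fintype.equivOfCardEq hcard)
  have hB := isUnit_conjMatrix p n b
    (B := fun i => WittVector.teichmuller p (b i)) fun i => WittVector.teichmuller_coeff_zero p _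
  let B := basisOfIsUnitConjMatrix p n hB
  have hBunit : IsUnit (conjMatrix p n B) := by
    rwa [show ⇑B = fun i => WittVector.teichmuller p (b i) from Module.Basis.coe_mk _ _]
  rw [show ⇑(shearingMap p n) = (conjMatrix p n B).mulVec ∘
    (Algebra.TensorProduct.basis (WittVector p (GaloisField p n)) B).equivFun from
      funext (shearingMap_eq_mulVec p n B)]
  exact Function.Bijective.comp ⟨Matrix.mulVec_injective_of_isUnit hBunit,
    Matrix.mulVec_surjective_iff_isUnit.2 hBunit⟩ (LinearEquiv.bijective _)
end

section
/- Let p be a prime and n ≥ 1, and let φ be the ring endomorphism of W(𝔽_{p^n}) induced by the p-power Frobenius x ↦ x^p of 𝔽_{p^n} via Witt vector functoriality. Then an element w ∈ W(𝔽_{p^n}) satisfies φ(w) = w if and only if w lies in the image of the canonical ring homomorphism W(𝔽_p) → W(𝔽_{p^n}); that is, the fixed subring of the Galois action on W(𝔽_{p^n}) is exactly ℤ_p. -/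
/-!
Let `φ` be the ring endomorphism of `W(𝔽_{p^n})` induced by the `p`-power Frobenius of
`𝔽_{p^n}` via Witt vector functoriality.  Then `φ(w) = w` if and only if `w` lies in the
image of the canonical ring homomorphism `W(𝔽_p) → W(𝔽_{p^n})`; i.e. the fixed subring of
the Galois action on `W(𝔽_{p^n})` is exactly `ℤ_p = W(𝔽_p)`.
-/

/-- An element of a field of characteristic `p` is fixed by Frobenius if and only if it comes from
the prime field. -/
theorem frobenius_eq_self_iff_mem_range_algebraMap (p : ℕ) [Fact p.Prime] {F : Type*} [Field F]
    [CharP F p] [Algebra (ZMod p) F] (x : F) :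
    frobenius F p x = x ↔ x ∈ (algebraMap (ZMod p) F).range := by
  rw [frobenius_def, ← Subfield.mem_bot_iff_pow_eq_self, ← ZMod.fieldRange_castHom_eq_bot p,
    Subsingleton.elim (ZMod.castHom _ F) (algebraMap (ZMod p) F), RingHom.mem_fieldRange,
    RingHom.mem_range]

namespace WittVector

/-- A Witt vector lies in the image of `WittVector.map f` if and only if all its coefficients lie in
the image of `f`. -/
theorem mem_range_map_iff {p : ℕ} [Fact p.Prime] {R S : Type*} [CommRing R] [CommRing S]
    (f : R →+* S) (w : WittVector p S) :
    w ∈ (WittVector.map f : WittVector p R →+* WittVector p S).range ↔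
      ∀ k, w.coeff k ∈ f.range := by
  constructor
  · rintro ⟨v, rfl⟩ k
    exact ⟨v.coeff k, (map_coeff f v k).symm⟩
  · intro h
    choose v hv using h
    exact ⟨mk p v, WittVector.ext fun k => by rw [map_coeff, coeff_mk, hv]⟩

end WittVector

theorem wittVector_frobenius_fixed_iff_mem_range (p n : ℕ) [Fact p.Prime] (hn : 1 ≤ n)
    (w : WittVector p (GaloisField p n)) :
    WittVector.map (frobenius (GaloisField p n) p) w = w ↔
      w ∈ (WittVector.map (algebraMap (ZMod p) (GaloisField p n))).range := by
  rw [WittVector.mem_range_map_iff, WittVector.ext_iff]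
  exact forall_congr' fun k => by
    rw [WittVector.map_coeff, frobenius_eq_self_iff_mem_range_algebraMap]
end

section
/- The fourth group cohomology of the quaternion group Q₈ of order 8 with coefficients in the trivial Q₈-module ℤ is isomorphic, as an abelian group, to ℤ/8. -/
/-!
The fourth group cohomology of the quaternion group `Q₈` with coefficients in the trivial
`Q₈`-module `ℤ` is isomorphic, as an abelian group, to `ℤ/8`.
-/

open CategoryTheory Limits

namespace Representation

/-- The representation of `G` on all functions `G → A` by right translation. -/
@[simps]
def rightTranslation (k G A : Type*) [CommRing k] [Group G] [AddCommGroup A] [Module k A] :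
    Representation k G (G → A) where
  toFun g := LinearMap.funLeft k A (· * g)
  map_one' := by ext; simp
  map_mul' _ _ := by ext; simp [mul_assoc]

end Representation

namespace Rep

variable {k G : Type} [CommRing k] [Group G]

/-- Functions on `G` are coinduced from the trivial subgroup. -/
noncomputable def rightTranslationIsoCoind (A : Type) [AddCommGroup A] [Module k A] :
    Rep.of (Representation.rightTranslation k G A) ≅
      coind (⊥ : Subgroup G).subtype (Rep.trivial k (⊥ : Subgroup G) A) :=
  mkIso <| .mk
    { toFun f := ⟨f, by rintro ⟨g, hg⟩ h; obtain rfl := Subgroup.mem_bot.1 hg; simp⟩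
      map_add' _ _ := rfl
      map_smul' _ _ := rfl
      invFun f := f.1
      left_inv _ := rfl
      right_inv _ := rfl } fun _ ↦ rfl

lemma isZero_groupCohomology_rightTranslation (A : Type) [AddCommGroup A] [Module k A] (n : ℕ) :
    IsZero (groupCohomology (Rep.of (Representation.rightTranslation k G A)) (n + 1)) :=
  ((isZero_groupCohomology_succ_of_subsingleton _ n).of_iso (groupCohomology.coindIso _ _)).of_iso
    ((groupCohomology.functor k G (n + 1)).mapIso (rightTranslationIsoCoind A))

lemma ofHom_comp_eq_zero {U V W : Type} [AddCommGroup U] [AddCommGroup V] [AddCommGroup W]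
    [Module k U] [Module k V] [Module k W] {ρ : Representation k G U} {σ : Representation k G V}
    {τ : Representation k G W} {f : ρ.IntertwiningMap σ} {g : σ.IntertwiningMap τ}
    (h : ∀ x, g (f x) = 0) : ofHom f ≫ ofHom g = 0 :=
  hom_ext <| DFunLike.ext _ _ h

/-- Exactness in `Rep k G` may be checked on elements. -/
lemma exact_of_forall {S : ShortComplex (Rep k G)}
    (h : ∀ y : S.X₂, S.g.hom y = 0 → ∃ x : S.X₁, S.f.hom x = y) : S.Exact := by
  rw [← ShortComplex.exact_map_iff_of_faithful S (forget₂ (Rep k G) (ModuleCat k)),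
    ShortComplex.moduleCat_exact_iff]
  exact h

/-- An exact sequence `0 ⟶ A ⟶ X ⟶ Y ⟶ Z` yields `0 ⟶ A ⟶ X ⟶ ker (Y ⟶ Z) ⟶ 0`. -/
lemma shortExact_kernelLift {A X Y Z : Rep k G} (f : A ⟶ X) (c : X ⟶ Y) (d : Y ⟶ Z) [Mono f]
    (hfc : f ≫ c = 0) (hcd : c ≫ d = 0) (hf : (ShortComplex.mk f c hfc).Exact)
    (hc : (ShortComplex.mk c d hcd).Exact) :
    (ShortComplex.mk f (kernel.lift d c hcd)
      (by simp [← cancel_mono (kernel.ι d), hfc])).ShortExact where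
  exact := by
    let φ : ShortComplex.mk f (kernel.lift d c hcd)
      (by simp [← cancel_mono (kernel.ι d), hfc]) ⟶ ShortComplex.mk f c hfc :=
      { τ₁ := 𝟙 _, τ₂ := 𝟙 _, τ₃ := kernel.ι d }
    have : Epi φ.τ₁ := inferInstanceAs (Epi (𝟙 A))
    have : IsIso φ.τ₂ := inferInstanceAs (IsIso (𝟙 X))
    have : Mono φ.τ₃ := inferInstanceAs (Mono (kernel.ι d))
    exact (ShortComplex.exact_iff_of_epi_of_isIso_of_mono φ).2 hf
  mono_f := ‹_›
  epi_g := hc.epi_kernelLift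

/-- Dimension shifting along functions on `G`. -/
noncomputable def dimensionShift {S : ShortComplex (Rep k G)} (hS : S.ShortExact) (n : ℕ)
    (h : ∀ n, IsZero (groupCohomology S.X₂ (n + 1))) :
    groupCohomology S.X₃ (n + 1) ≅ groupCohomology S.X₁ (n + 2) :=
  haveI := groupCohomology.isIso_δ_of_isZero hS (n + 1) (h n) (h (n + 1))
  asIso (groupCohomology.δ hS (n + 1) (n + 2) rfl)

/-- If `0 ⟶ X₁ ⟶ X₂ ⟶ X₃ ⟶ 0` is exact and `H¹(G, X₂) = 0` then `H¹(G, X₁)` is the quotient of the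
invariants of `X₃` by the image of the invariants of `X₂`. -/
noncomputable def H1EquivOfShortExact {S : ShortComplex (Rep k G)} (hS : S.ShortExact)
    (h : IsZero (groupCohomology S.X₂ 1)) :
    (S.X₃.ρ.invariants ⧸ LinearMap.range ((invariantsFunctor k G).map S.g).hom) ≃ₗ[k]
      groupCohomology S.X₁ 1 :=
  have := groupCohomology.epi_δ_of_isZero hS 0 h
  have hr : LinearMap.range ((invariantsFunctor k G).map S.g).hom =
      LinearMap.ker ((groupCohomology.H0Iso S.X₃).inv ≫ groupCohomology.δ hS 0 1 rfl).hom := by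
    have e := (groupCohomology.mapShortComplex₃_exact hS (i := 0) rfl).moduleCat_range_eq_ker
    have h0 : (groupCohomology.H0Iso S.X₂).inv ≫ groupCohomology.map (MonoidHom.id G) S.g 0 =
        (invariantsFunctor k G).map S.g ≫ (groupCohomology.H0Iso S.X₃).inv := by
      rw [Iso.inv_comp_eq, ← Category.assoc, Iso.eq_comp_inv,
        groupCohomology.map_id_comp_H0Iso_hom]
    ext x
    have hx := SetLike.ext_iff.1 e ((groupCohomology.H0Iso S.X₃).inv x)
    refine Iff.trans ?_ hx
    constructor
    · rintro ⟨y, rfl⟩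
      refine ⟨(groupCohomology.H0Iso S.X₂).inv y, ?_⟩
      exact ConcreteCategory.congr_hom h0 y
    · rintro ⟨y, hy⟩
      refine ⟨(groupCohomology.H0Iso S.X₂).hom y, ?_⟩
      refine (ConcreteCategory.congr_hom
        (groupCohomology.map_id_comp_H0Iso_hom S.g) y).symm.trans ?_
      refine (congrArg (groupCohomology.H0Iso S.X₃).hom hy).trans ?_
      simp
  (Submodule.quotEquivOfEq _ _ hr).trans <| LinearMap.quotKerEquivOfSurjective _ <|
    (ModuleCat.epi_iff_surjective _).1 inferInstance

end Rep

namespace QuaternionGroup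

open Representation

/-- The embedding of `ℤ` as the constant functions on `Q₈`. -/
def constants : (trivial ℤ (QuaternionGroup 2) ℤ).IntertwiningMap
    (rightTranslation ℤ (QuaternionGroup 2) ℤ) where
  toFun n _ := n
  map_add' _ _ := rfl
  map_smul' _ _ := rfl
  isIntertwining' _ := rfl

/-- The differential given by the generators `a 1` and `xa 0` of `Q₈`. -/
def d₁ : (rightTranslation ℤ (QuaternionGroup 2) ℤ).IntertwiningMap
    (rightTranslation ℤ (QuaternionGroup 2) (ℤ × ℤ)) where
  toFun f x := (f (a 1 * x) - f x, f (xa 0 * x) - f x)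
  map_add' _ _ := by ext <;> simp <;> ring
  map_smul' _ _ := by ext <;> simp <;> ring
  isIntertwining' _ := by ext <;> simp [mul_assoc]

/-- The differential given by the Fox derivatives of the two defining relations of `Q₈`. -/
def d₂ : (rightTranslation ℤ (QuaternionGroup 2) (ℤ × ℤ)).IntertwiningMap
    (rightTranslation ℤ (QuaternionGroup 2) (ℤ × ℤ)) where
  toFun f x := ((f x).1 + (f (a 1 * x)).1 - (f x).2 - (f (xa 0 * x)).2,
    (f x).1 + (f (xa 1 * x)).1 + (f (a 1 * x)).2 - (f x).2)
  map_add' _ _ := by ext <;> simp <;> ring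
  map_smul' _ _ := by ext <;> simp <;> ring
  isIntertwining' _ := by ext <;> simp [mul_assoc]

/-- The differential given by the identity among the two defining relations of `Q₈`. -/
def d₃ : (rightTranslation ℤ (QuaternionGroup 2) (ℤ × ℤ)).IntertwiningMap
    (rightTranslation ℤ (QuaternionGroup 2) ℤ) where
  toFun f x := (f (a 1 * x)).1 - (f x).1 + (f x).2 - (f (xa 1 * x)).2
  map_add' _ _ := by ext; simp; ring
  map_smul' _ _ := by ext; simp; ring
  isIntertwining' _ := LinearMap.ext fun _ ↦ funext fun _ ↦ by simp [mul_assoc]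

/-- Summation of a function over `Q₈`. -/
def total : (rightTranslation ℤ (QuaternionGroup 2) ℤ).IntertwiningMap
    (trivial ℤ (QuaternionGroup 2) ℤ) where
  toFun f := ∑ x, f x
  map_add' _ _ := by simp [Finset.sum_add_distrib]
  map_smul' _ _ := by simp [Finset.mul_sum]
  isIntertwining' g := LinearMap.ext fun f ↦ Equiv.sum_comp (Equiv.mulRight g) f

lemma forall_iff {p : QuaternionGroup 2 → Prop} : (∀ x, p x) ↔
    p (a 0) ∧ p (a 1) ∧ p (a 2) ∧ p (a 3) ∧ p (xa 0) ∧ p (xa 1) ∧ p (xa 2) ∧ p (xa 3) := by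
  refine ⟨fun h ↦ ⟨h _, h _, h _, h _, h _, h _, h _, h _⟩, ?_⟩
  rintro ⟨h0, h1, h2, h3, k0, k1, k2, k3⟩ (i | i)
  · change Fin 4 at i
    fin_cases i <;> assumption
  · change Fin 4 at i
    fin_cases i <;> assumption

lemma exists_values {A : Type*} (u₀ u₁ u₂ u₃ v₀ v₁ v₂ v₃ : A) : ∃ f : QuaternionGroup 2 → A,
    (f (a 0) = u₀ ∧ f (a 1) = u₁ ∧ f (a 2) = u₂ ∧ f (a 3) = u₃) ∧
    (f (xa 0) = v₀ ∧ f (xa 1) = v₁ ∧ f (xa 2) = v₂ ∧ f (xa 3) = v₃) :=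
  ⟨fun
    | a i => (![u₀, u₁, u₂, u₃] : Fin 4 → A) i
    | xa i => (![v₀, v₁, v₂, v₃] : Fin 4 → A) i, ⟨rfl, rfl, rfl, rfl⟩, rfl, rfl, rfl, rfl⟩

lemma sum_eq (f : QuaternionGroup 2 → ℤ) : ∑ x, f x = f (a 0) + f (a 1) + f (a 2) + f (a 3) +
    f (xa 0) + f (xa 1) + f (xa 2) + f (xa 3) := by
  let e : Fin 4 ⊕ Fin 4 ≃ QuaternionGroup 2 :=
    { toFun := Sum.elim (a (n := 2)) (xa (n := 2))
      invFun
        | a i => Sum.inl i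
        | xa i => Sum.inr i
      left_inv := by rintro (i | i) <;> rfl
      right_inv := by rintro (i | i) <;> rfl }
  rw [← e.sum_comp, Fintype.sum_sum_type, Fin.sum_univ_four, Fin.sum_univ_four]
  simp only [← add_assoc]
  rfl

lemma mul_table :
    ((a 1 * a 0 : QuaternionGroup 2) = a 1 ∧ (a 1 * a 1 : QuaternionGroup 2) = a 2 ∧
      (a 1 * a 2 : QuaternionGroup 2) = a 3 ∧ (a 1 * a 3 : QuaternionGroup 2) = a 0 ∧
      (a 1 * xa 0 : QuaternionGroup 2) = xa 3 ∧ (a 1 * xa 1 : QuaternionGroup 2) = xa 0 ∧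
      (a 1 * xa 2 : QuaternionGroup 2) = xa 1 ∧ (a 1 * xa 3 : QuaternionGroup 2) = xa 2) ∧
    ((xa 0 * a 0 : QuaternionGroup 2) = xa 0 ∧ (xa 0 * a 1 : QuaternionGroup 2) = xa 1 ∧
      (xa 0 * a 2 : QuaternionGroup 2) = xa 2 ∧ (xa 0 * a 3 : QuaternionGroup 2) = xa 3 ∧
      (xa 0 * xa 0 : QuaternionGroup 2) = a 2 ∧ (xa 0 * xa 1 : QuaternionGroup 2) = a 3 ∧
      (xa 0 * xa 2 : QuaternionGroup 2) = a 0 ∧ (xa 0 * xa 3 : QuaternionGroup 2) = a 1) ∧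
    ((xa 1 * a 0 : QuaternionGroup 2) = xa 1 ∧ (xa 1 * a 1 : QuaternionGroup 2) = xa 2 ∧
      (xa 1 * a 2 : QuaternionGroup 2) = xa 3 ∧ (xa 1 * a 3 : QuaternionGroup 2) = xa 0 ∧
      (xa 1 * xa 0 : QuaternionGroup 2) = a 1 ∧ (xa 1 * xa 1 : QuaternionGroup 2) = a 2 ∧
      (xa 1 * xa 2 : QuaternionGroup 2) = a 3 ∧ (xa 1 * xa 3 : QuaternionGroup 2) = a 0) := by
  simp only [a_mul_a, a_mul_xa, xa_mul_a, xa_mul_xa]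
  decide

lemma d₁_constants (n : ℤ) : d₁ (constants n) = 0 :=
  funext fun _ ↦ Prod.ext (sub_self n) (sub_self n)

lemma d₂_d₁ (f : QuaternionGroup 2 → ℤ) : d₂ (d₁ f) = 0 := by
  obtain ⟨z, hz⟩ : ∃ z, z = d₁ f := ⟨_, rfl⟩
  have h : ∀ x, z x = (f (a 1 * x) - f x, f (xa 0 * x) - f x) := congrFun hz
  suffices ∀ x, (z x).1 + (z (a 1 * x)).1 - (z x).2 - (z (xa 0 * x)).2 = 0 ∧
      (z x).1 + (z (xa 1 * x)).1 + (z (a 1 * x)).2 - (z x).2 = 0 from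
    hz ▸ funext fun x ↦ Prod.ext_iff.2 (this x)
  simp only [h, forall_iff, mul_table]
  omega

lemma d₃_d₂ (f : QuaternionGroup 2 → ℤ × ℤ) : d₃ (d₂ f) = 0 := by
  obtain ⟨z, hz⟩ : ∃ z, z = d₂ f := ⟨_, rfl⟩
  have h : ∀ x, z x = ((f x).1 + (f (a 1 * x)).1 - (f x).2 - (f (xa 0 * x)).2,
    (f x).1 + (f (xa 1 * x)).1 + (f (a 1 * x)).2 - (f x).2) := congrFun hz
  suffices ∀ x, (z (a 1 * x)).1 - (z x).1 + (z x).2 - (z (xa 1 * x)).2 = 0 from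
    hz ▸ funext this
  simp only [h, forall_iff, mul_table]
  omega

lemma total_d₃ (f : QuaternionGroup 2 → ℤ × ℤ) : total (d₃ f) = 0 := by
  change ∑ x, ((f (a 1 * x)).1 - (f x).1 + (f x).2 - (f (xa 1 * x)).2) = 0
  simp only [sum_eq, mul_table]
  ring

lemma exists_constants_eq (y : QuaternionGroup 2 → ℤ) (hy : d₁ y = 0) : ∃ n, constants n = y := by
  have h : ∀ x, y (a 1 * x) - y x = 0 ∧ y (xa 0 * x) - y x = 0 :=
    fun x ↦ Prod.mk_eq_zero.1 (congrFun hy x)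
  refine ⟨y (a 0), funext <| (forall_iff (p := fun x ↦ y (a 0) = y x)).2 ?_⟩
  simp only [forall_iff, mul_table] at h
  omega

lemma exists_d₁_eq (y : QuaternionGroup 2 → ℤ × ℤ) (hy : d₂ y = 0) : ∃ x, d₁ x = y := by
  have h : ∀ x, (y x).1 + (y (a 1 * x)).1 - (y x).2 - (y (xa 0 * x)).2 = 0 ∧
      (y x).1 + (y (xa 1 * x)).1 + (y (a 1 * x)).2 - (y x).2 = 0 :=
    fun x ↦ Prod.mk_eq_zero.1 (congrFun hy x)
  obtain ⟨z, hz⟩ := exists_values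
    (-(y (xa 0)).1 - (y (a 0)).2) (y (xa 3)).2 ((y (xa 3)).1 - (y (a 2)).2) (-(y (a 3)).2)
    (-(y (xa 0)).1) (-(y (a 3)).2 - (y (xa 1)).2) (y (xa 3)).1 0
  suffices ∀ x, z (a 1 * x) - z x = (y x).1 ∧ z (xa 0 * x) - z x = (y x).2 from
    ⟨z, funext fun x ↦ Prod.ext_iff.2 (this x)⟩
  simp only [forall_iff, mul_table, hz] at h ⊢
  omega

lemma exists_d₂_eq (y : QuaternionGroup 2 → ℤ × ℤ) (hy : d₃ y = 0) : ∃ x, d₂ x = y := by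
  have h : ∀ x, (y (a 1 * x)).1 - (y x).1 + (y x).2 - (y (xa 1 * x)).2 = 0 := congrFun hy
  obtain ⟨z, hz⟩ := exists_values (0, 0) (0, (y (a 0)).2)
    ((y (a 0)).1 - (y (xa 1)).1 + (y (xa 1)).2, -(y (xa 2)).1 + (y (a 0)).2 + (y (a 1)).2)
    ((y (a 3)).2, 0) (0, -(y (a 0)).1) (0, -(y (xa 1)).1) ((y (xa 2)).1, 0)
    (-(y (a 0)).1 + (y (xa 0)).1 - (y (xa 2)).1 + (y (a 0)).2 + (y (a 1)).2,
      -(y (a 0)).1 + (y (xa 0)).2)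
  suffices ∀ x, (z x).1 + (z (a 1 * x)).1 - (z x).2 - (z (xa 0 * x)).2 = (y x).1 ∧
      (z x).1 + (z (xa 1 * x)).1 + (z (a 1 * x)).2 - (z x).2 = (y x).2 from
    ⟨z, funext fun x ↦ Prod.ext_iff.2 (this x)⟩
  simp only [forall_iff, mul_table, hz] at h ⊢
  omega

lemma exists_d₃_eq (y : QuaternionGroup 2 → ℤ) (hy : total y = 0) : ∃ x, d₃ x = y := by
  have h : ∑ x, y x = 0 := hy
  obtain ⟨z, hz⟩ := exists_values (0, y (a 0)) (0, y (a 1)) (0, -y (xa 1)) (0, 0)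
    (0, -y (a 3)) (0, 0) (-y (xa 2), 0)
    (y (a 1) + y (a 3) + y (xa 0), -y (a 2) - y (xa 1))
  suffices ∀ x, (z (a 1 * x)).1 - (z x).1 + (z x).2 - (z (xa 1 * x)).2 = y x from
    ⟨z, funext this⟩
  simp only [forall_iff, mul_table, hz, sum_eq] at h ⊢
  omega

lemma total_surjective : Function.Surjective total := fun n ↦ by
  obtain ⟨f, hf⟩ := exists_values n 0 0 0 0 0 0 0
  refine ⟨f, (sum_eq f).trans ?_⟩
  simp only [hf, add_zero]

/-- The invariants of `ℤ[Q₈]` map onto the multiples of `8` under summation. -/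
lemma total_invariants_range :
    LinearMap.range ((Rep.invariantsFunctor ℤ (QuaternionGroup 2)).map (Rep.ofHom total)).hom =
      LinearMap.ker ((Int.castAddHom (ZMod 8)).toIntLinearMap ∘ₗ
        (trivial ℤ (QuaternionGroup 2) ℤ).invariants.subtype) := by
  ext ⟨n, hn⟩
  rw [LinearMap.mem_ker]
  refine Iff.trans ?_ (ZMod.intCast_zmod_eq_zero_iff_dvd n 8).symm
  constructor
  · rintro ⟨⟨f, hf⟩, h⟩
    have hc (x : QuaternionGroup 2) : f x = f 1 := by
      simpa using congrFun (hf x) 1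
    have h : ∑ x, f x = n := congrArg Subtype.val h
    refine ⟨f 1, ?_⟩
    simp only [hc] at h
    rw [← h, Finset.sum_const, Finset.card_univ, card, nsmul_eq_mul]
  · rintro ⟨m, rfl⟩
    refine ⟨⟨fun _ ↦ m, fun _ ↦ rfl⟩, Subtype.ext ?_⟩
    change ∑ x : QuaternionGroup 2, m = 8 * m
    rw [sum_eq]
    ring

end QuaternionGroup

open QuaternionGroup

theorem H4_Q8_trivial_int :
    Nonempty ((groupCohomology (Rep.trivial ℤ (QuaternionGroup 2) ℤ) 4) ≃+ ZMod 8) := by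
  have : Mono (Rep.ofHom constants) :=
    (Rep.mono_iff_injective _).2 fun _ _ h ↦ congrFun h 1
  have : Epi (Rep.ofHom total) := (Rep.epi_iff_surjective _).2 total_surjective
  have e₀ := Rep.ofHom_comp_eq_zero d₁_constants
  have e₁ := Rep.ofHom_comp_eq_zero d₂_d₁
  have e₂ := Rep.ofHom_comp_eq_zero d₃_d₂
  have e₃ := Rep.ofHom_comp_eq_zero total_d₃
  have x₁ : (ShortComplex.mk _ _ e₀).Exact := Rep.exact_of_forall exists_constants_eq
  have x₂ : (ShortComplex.mk _ _ e₁).Exact := Rep.exact_of_forall exists_d₁_eq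
  have x₃ : (ShortComplex.mk _ _ e₂).Exact := Rep.exact_of_forall exists_d₂_eq
  have x₄ : (ShortComplex.mk _ _ e₃).Exact := Rep.exact_of_forall exists_d₃_eq
  have s₁ := Rep.shortExact_kernelLift _ _ _ e₀ e₁ x₁ x₂
  have s₂ := Rep.shortExact_kernelLift _ _ _ (kernel.condition _) e₂
    (ShortComplex.exact_kernel _) x₃
  have s₃ := Rep.shortExact_kernelLift _ _ _ (kernel.condition _) e₃
    (ShortComplex.exact_kernel _) x₄
  have s₄ : (ShortComplex.mk _ _ (kernel.condition (Rep.ofHom total))).ShortExact :=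
    { exact := ShortComplex.exact_kernel _ }
  have i₁ := Rep.dimensionShift s₁ 2 (Rep.isZero_groupCohomology_rightTranslation _)
  have i₂ := Rep.dimensionShift s₂ 1 (Rep.isZero_groupCohomology_rightTranslation _)
  have i₃ := Rep.dimensionShift s₃ 0 (Rep.isZero_groupCohomology_rightTranslation _)
  have i₄ := Rep.H1EquivOfShortExact s₄ (Rep.isZero_groupCohomology_rightTranslation _ 0)
  have q := (Submodule.quotEquivOfEq _ _ total_invariants_range).trans
    (LinearMap.quotKerEquivOfSurjective _ fun x ↦ by
      obtain ⟨n, rfl⟩ := ZMod.intCast_surjective x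
      exact ⟨⟨n, fun _ ↦ rfl⟩, rfl⟩)
  exact ⟨((i₃ ≪≫ i₂ ≪≫ i₁).symm.toLinearEquiv.trans (i₄.symm.trans q)).toAddEquiv⟩
end

section
/- For every prime p, the quotient of the group of units ℤ_pˣ of the ring of p-adic integers by its torsion subgroup is isomorphic, as a group, to the additive group of ℤ_p. Moreover, for p = 2 the torsion subgroup of ℤ₂ˣ is exactly {1, −1}. -/
/-!
For every prime `p`, the quotient of `ℤ_pˣ` by its torsion subgroup (its maximal finite
subgroup) is isomorphic to the additive group of `ℤ_p`; moreover for `p = 2` the torsion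
subgroup of `ℤ₂ˣ` is exactly `{1, -1}`.
-/

/-- An isometry of a compact metric space into itself is surjective. -/
theorem Isometry.surjective_of_compactSpace {α : Type*} [MetricSpace α] [CompactSpace α]
    {f : α → α} (hf : Isometry f) : Function.Surjective f := by
  intro y
  by_contra hy
  have hclosed : IsClosed (Set.range f) := (isCompact_range hf.continuous).isClosed
  obtain ⟨ε, hε, hball⟩ := Metric.isOpen_iff.mp hclosed.isOpen_compl y hy
  have hfar (x : α) : ε ≤ dist (f x) y := by
    by_contra! h
    exact hball (Metric.mem_ball.mpr h) ⟨x, rfl⟩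
  have hiter (m k : ℕ) : ε ≤ dist (f^[m + (k + 1)] y) (f^[m] y) := by
    have hm : Isometry f^[m] := Nat.rec isometry_id (fun _ ih ↦ ih.comp hf) m
    rw [Function.iterate_add_apply, hm.dist_eq, Function.iterate_succ_apply']
    exact hfar _
  obtain ⟨_, -, φ, hφ, hlim⟩ := isCompact_univ.tendsto_subseq (x := fun n ↦ f^[n] y) (by simp)
  obtain ⟨N, hN⟩ := Metric.cauchySeq_iff'.mp hlim.cauchySeq ε hε
  obtain ⟨k, hk⟩ := Nat.exists_eq_add_of_lt (hφ N.lt_succ_self)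
  have hlt := hN (N + 1) N.le_succ
  simp only [Function.comp_apply] at hlt
  rw [show φ (N + 1) = φ N + (k + 1) by rw [hk, add_assoc]] at hlt
  exact hlt.not_ge (hiter _ _)

namespace PadicInt

variable {p : ℕ} [hp : Fact p.Prime]

theorem dvd_of_norm_le_norm {x y : ℤ_[p]} (h : ‖x‖ ≤ ‖y‖) : y ∣ x := by
  by_cases hy : y = 0
  · simp_all
  · rw [norm_eq_zpow_neg_valuation hy, norm_le_pow_iff_mem_span_pow,
      Ideal.mem_span_singleton] at h
    rw [unitCoeff_spec hy]
    exact (Units.isUnit _).mul_left_dvd.mpr h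

theorem norm_intCast_eq_of_emultiplicity_eq {a b : ℤ}
    (h : emultiplicity (p : ℤ) a = emultiplicity (p : ℤ) b) : ‖(a : ℤ_[p])‖ = ‖(b : ℤ_[p])‖ := by
  rw [emultiplicity_eq_emultiplicity_iff] at h
  have key {a b : ℤ} (h : ∀ n : ℕ, (p : ℤ) ^ n ∣ a → (p : ℤ) ^ n ∣ b) :
      ‖(b : ℤ_[p])‖ ≤ ‖(a : ℤ_[p])‖ := by
    by_cases ha : (a : ℤ_[p]) = 0
    · rw [ha, norm_zero]
      refine le_of_forall_pos_le_add fun ε hε ↦ ?_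
      obtain ⟨k, hk⟩ := exists_pow_neg_lt p hε
      have ha' : a = 0 := by exact_mod_cast ha
      have := norm_int_le_pow_iff_dvd.mpr (by exact_mod_cast h k (ha' ▸ dvd_zero _))
      linarith
    · rw [norm_eq_zpow_neg_valuation ha]
      exact norm_int_le_pow_iff_dvd.mpr (by
        exact_mod_cast h _ (by
          exact_mod_cast norm_int_le_pow_iff_dvd.mp (norm_eq_zpow_neg_valuation ha).le))
  exact le_antisymm (key fun n ↦ (h n).mpr) (key fun n ↦ (h n).mp)

theorem norm_one_add_pow_sub_one {q : ℤ} (hq : (p : ℤ) ∣ q) (h2 : p = 2 → 4 ∣ q) (n : ℕ) :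
    ‖((1 + q) ^ n - 1 : ℤ_[p])‖ = ‖(q : ℤ_[p])‖ * ‖(n : ℤ_[p])‖ := by
  have hpp : Prime (p : ℤ) := Nat.prime_iff_prime_int.mp hp.out
  have hx : ¬ (p : ℤ) ∣ 1 + q := fun h ↦ hpp.not_dvd_one ((dvd_add_left hq).mp h)
  have key : emultiplicity (p : ℤ) ((1 + q) ^ n - 1 ^ n) = emultiplicity (p : ℤ) (q * n) := by
    rw [emultiplicity_mul hpp]
    rcases hp.out.eq_two_or_odd' with rfl | hodd
    · have := Int.two_pow_sub_pow' (x := 1 + q) (y := 1) n (by simpa using h2 rfl) (by simpa using hx)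
      simpa using this
    · have := Int.emultiplicity_pow_sub_pow hp.out hodd (x := 1 + q) (y := 1) (by simpa using hq) hx n
      rw [this, Int.natCast_emultiplicity, add_sub_cancel_left]
  simpa using norm_intCast_eq_of_emultiplicity_eq key

variable (p) in
/-- The hypothesis on `q` under which `x ↦ (1 + q) ^ x` maps `ℤ_[p]` isomorphically onto
`1 + q ℤ_[p]`. -/
structure IsExpBase (q : ℤ) : Prop where
  ne_zero : q ≠ 0
  dvd : (p : ℤ) ∣ q
  four_dvd : p = 2 → 4 ∣ q

namespace IsExpBase

variable {q : ℤ}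

theorem tendsto_pow (hq : IsExpBase p q) :
    Filter.Tendsto ((q : ℤ_[p]) ^ ·) Filter.atTop (nhds 0) :=
  tendsto_pow_atTop_nhds_zero_iff_norm_lt_one.mpr ((norm_int_lt_one_iff_dvd q).mpr hq.dvd)

/-- The continuous character `x ↦ (1 + q) ^ x` of `ℤ_[p]`. -/
noncomputable def char (hq : IsExpBase p q) : AddChar ℤ_[p] ℤ_[p] :=
  addChar_of_value_at_one (q : ℤ_[p]) hq.tendsto_pow

theorem continuous_char (hq : IsExpBase p q) : Continuous hq.char :=
  continuous_addChar_of_value_at_one hq.tendsto_pow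

theorem char_natCast (hq : IsExpBase p q) (n : ℕ) : hq.char n = (1 + q) ^ n := by
  rw [← nsmul_one, AddChar.map_nsmul_eq_pow, char, addChar_of_value_at_one_def]

theorem norm_char_sub_one (hq : IsExpBase p q) (x : ℤ_[p]) :
    ‖hq.char x - 1‖ = ‖(q : ℤ_[p])‖ * ‖x‖ := by
  have hc := hq.continuous_char
  refine congr_fun (denseRange_natCast.equalizer (g := fun x ↦ ‖hq.char x - 1‖)
    (h := fun x ↦ ‖(q : ℤ_[p])‖ * ‖x‖) (by fun_prop) (by fun_prop) (funext fun n ↦ ?_)) x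
  simpa [hq.char_natCast] using norm_one_add_pow_sub_one hq.dvd hq.four_dvd n

theorem norm_char (hq : IsExpBase p q) (x : ℤ_[p]) : ‖hq.char x‖ = 1 :=
  isUnit_iff.mp (AddChar.val_isUnit hq.char x)

theorem norm_char_sub_char (hq : IsExpBase p q) (x y : ℤ_[p]) :
    ‖hq.char x - hq.char y‖ = ‖(q : ℤ_[p])‖ * ‖x - y‖ := by
  have : hq.char x - hq.char y = hq.char y * (hq.char (x - y) - 1) := by
    rw [mul_sub, ← AddChar.map_add_eq_mul, add_sub_cancel, mul_one]
  rw [this, norm_mul, norm_char, one_mul, norm_char_sub_one]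

theorem char_injective (hq : IsExpBase p q) : Function.Injective hq.char := by
  intro x y h
  have h0 := hq.norm_char_sub_char x y
  have hq0 : (q : ℤ_[p]) ≠ 0 := by exact_mod_cast hq.ne_zero
  simpa [h, hq0, sub_eq_zero] using h0

theorem dvd_char_sub_one (hq : IsExpBase p q) (x : ℤ_[p]) : (q : ℤ_[p]) ∣ hq.char x - 1 := by
  refine dvd_of_norm_le_norm ?_
  rw [norm_char_sub_one]
  exact mul_le_of_le_one_right (norm_nonneg _) (norm_le_one x)

theorem exists_char_eq (hq : IsExpBase p q) {u : ℤ_[p]} (hu : (q : ℤ_[p]) ∣ u - 1) :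
    ∃ x, hq.char x = u := by
  have hq0 : (q : ℤ_[p]) ≠ 0 := by exact_mod_cast hq.ne_zero
  choose f hf using hq.dvd_char_sub_one
  have hiso : Isometry f := Isometry.of_dist_eq fun x y ↦ by
    refine mul_left_cancel₀ (norm_ne_zero_iff.mpr hq0) ?_
    rw [dist_eq_norm, dist_eq_norm, ← norm_mul, mul_sub, ← hf, ← hf, sub_sub_sub_cancel_right,
      norm_char_sub_char]
  obtain ⟨y, hy⟩ := hu
  obtain ⟨x, rfl⟩ := hiso.surjective_of_compactSpace y
  exact ⟨x, sub_left_injective (hf x |>.trans hy.symm)⟩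

/-- The homomorphism `x ↦ (1 + q) ^ x` from `ℤ_[p]` to its group of units. -/
noncomputable def unitsHom (hq : IsExpBase p q) : Multiplicative ℤ_[p] →* ℤ_[p]ˣ :=
  hq.char.toMonoidHom.toHomUnits

theorem val_unitsHom (hq : IsExpBase p q) (x : Multiplicative ℤ_[p]) :
    (hq.unitsHom x : ℤ_[p]) = hq.char x.toAdd := rfl

theorem unitsHom_injective (hq : IsExpBase p q) : Function.Injective hq.unitsHom :=
  fun _ _ h ↦ hq.char_injective (congrArg Units.val h)

theorem exists_unitsHom_eq (hq : IsExpBase p q) {u : ℤ_[p]ˣ} (hu : (q : ℤ_[p]) ∣ u - 1) :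
    ∃ x, hq.unitsHom x = u :=
  let ⟨x, hx⟩ := hq.exists_char_eq hu
  ⟨Multiplicative.ofAdd x, Units.ext hx⟩

theorem unitsHom_mem_torsion_iff (hq : IsExpBase p q) (x : Multiplicative ℤ_[p]) :
    hq.unitsHom x ∈ CommGroup.torsion ℤ_[p]ˣ ↔ x = 1 := by
  rw [CommGroup.mem_torsion, hq.unitsHom_injective.isOfFinOrder_iff, isOfFinOrder_iff_eq_one]

/-- If every unit is the product of a torsion element and an element of the image of
`x ↦ (1 + q) ^ x`, then the units modulo torsion are isomorphic to `ℤ_[p]`. -/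
theorem nonempty_quotient_torsion_mulEquiv (hq : IsExpBase p q)
    (h : ∀ u : ℤ_[p]ˣ, ∃ x, (hq.unitsHom x)⁻¹ * u ∈ CommGroup.torsion ℤ_[p]ˣ) :
    Nonempty ((ℤ_[p]ˣ ⧸ CommGroup.torsion ℤ_[p]ˣ) ≃* Multiplicative ℤ_[p]) := by
  refine ⟨(MulEquiv.ofBijective
    ((QuotientGroup.mk' (CommGroup.torsion ℤ_[p]ˣ)).comp hq.unitsHom) ⟨?_, fun y ↦ ?_⟩).symm⟩
  · rw [injective_iff_map_eq_one]
    intro x hx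
    exact (hq.unitsHom_mem_torsion_iff x).mp ((QuotientGroup.eq_one_iff _).mp hx)
  · obtain ⟨u, rfl⟩ := QuotientGroup.mk_surjective y
    exact (h u).imp fun x hx ↦ QuotientGroup.eq.mpr hx

end IsExpBase

theorem isExpBase_prime (h : p ≠ 2) : IsExpBase p p :=
  ⟨by exact_mod_cast hp.out.ne_zero, dvd_rfl, fun h' ↦ absurd h' h⟩

theorem isExpBase_four : IsExpBase 2 4 := ⟨by decide, by decide, fun _ ↦ dvd_rfl⟩

theorem natCast_dvd_units_pow_sub_one (u : ℤ_[p]ˣ) : (p : ℤ_[p]) ∣ (u : ℤ_[p]) ^ (p - 1) - 1 := by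
  rw [← Ideal.mem_span_singleton, ← maximalIdeal_eq_span_p, ← ker_toZMod, RingHom.mem_ker,
    map_sub, map_pow, map_one, sub_eq_zero]
  exact ZMod.pow_card_sub_one_eq_one (u.isUnit.map toZMod).ne_zero

theorem exists_inv_mul_mem_torsion (h : p ≠ 2) (u : ℤ_[p]ˣ) :
    ∃ x, ((isExpBase_prime h).unitsHom x)⁻¹ * u ∈ CommGroup.torsion ℤ_[p]ˣ := by
  have hpos : 0 < p - 1 := Nat.sub_pos_of_lt hp.out.one_lt
  obtain ⟨y, hy⟩ := (isExpBase_prime h).exists_unitsHom_eq (u := u ^ (p - 1))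
    (by simpa using natCast_dvd_units_pow_sub_one u)
  obtain ⟨v, hv⟩ : IsUnit ((p - 1 : ℕ) : ℤ_[p]) := by
    rw [isUnit_iff, norm_natCast_eq_one_iff]
    exact Nat.coprime_of_lt_prime hpos.ne' (by omega) hp.out
  refine ⟨Multiplicative.ofAdd ((v⁻¹ : ℤ_[p]ˣ) * y.toAdd), ?_⟩
  rw [CommGroup.mem_torsion, isOfFinOrder_iff_pow_eq_one]
  refine ⟨p - 1, hpos, ?_⟩
  rw [mul_pow, inv_pow, ← map_pow, ← hy, ← ofAdd_nsmul, nsmul_eq_mul, ← hv, Units.mul_inv_cancel_left,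
    ofAdd_toAdd, inv_mul_cancel]

theorem four_dvd_units_sub_one_or_neg_sub_one (u : ℤ_[2]ˣ) :
    (4 : ℤ_[2]) ∣ u - 1 ∨ (4 : ℤ_[2]) ∣ -u - 1 := by
  have key (x : ZMod (2 ^ 2)) (hx : IsUnit x) : x - 1 = 0 ∨ -x - 1 = 0 := by
    revert x; decide
  have hmem (x : ℤ_[2]) : toZModPow 2 x = 0 ↔ (4 : ℤ_[2]) ∣ x := by
    rw [← RingHom.mem_ker, ker_toZModPow, Ideal.mem_span_singleton]
    norm_num
  simpa [← hmem] using key _ (u.isUnit.map (toZModPow 2))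

theorem exists_unitsHom_eq_or_neg_eq (u : ℤ_[2]ˣ) :
    ∃ x, isExpBase_four.unitsHom x = u ∨ isExpBase_four.unitsHom x = -u := by
  rcases four_dvd_units_sub_one_or_neg_sub_one u with h | h
  · exact (isExpBase_four.exists_unitsHom_eq (by simpa using h)).imp fun _ ↦ Or.inl
  · exact (isExpBase_four.exists_unitsHom_eq (by simpa using h)).imp fun _ ↦ Or.inr

theorem neg_one_mem_torsion_units : (-1 : ℤ_[p]ˣ) ∈ CommGroup.torsion ℤ_[p]ˣ :=
  isOfFinOrder_iff_pow_eq_one.mpr ⟨2, two_pos, by simp⟩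

theorem exists_inv_mul_mem_torsion_two (u : ℤ_[2]ˣ) :
    ∃ x, (isExpBase_four.unitsHom x)⁻¹ * u ∈ CommGroup.torsion ℤ_[2]ˣ := by
  refine (exists_unitsHom_eq_or_neg_eq u).imp fun x hx ↦ ?_
  rcases hx with hx | hx
  · simp [hx]
  · rw [hx, inv_neg, neg_mul, inv_mul_cancel]
    exact neg_one_mem_torsion_units

theorem mem_torsion_units_two_iff (u : ℤ_[2]ˣ) :
    u ∈ CommGroup.torsion ℤ_[2]ˣ ↔ u = 1 ∨ u = -1 := by
  refine ⟨fun hu ↦ ?_, ?_⟩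
  · obtain ⟨x, hx | hx⟩ := exists_unitsHom_eq_or_neg_eq u
    · left
      rw [← hx, isExpBase_four.unitsHom_mem_torsion_iff] at hu
      rw [← hx, hu, map_one]
    · right
      have hneg : -u ∈ CommGroup.torsion ℤ_[2]ˣ := by
        simpa using mul_mem neg_one_mem_torsion_units hu
      rw [← hx, isExpBase_four.unitsHom_mem_torsion_iff] at hneg
      rw [← neg_eq_iff_eq_neg, ← hx, hneg, map_one]
  · rintro (rfl | rfl)
    exacts [one_mem _, neg_one_mem_torsion_units]

end PadicInt

theorem padic_units_mod_torsion :
    (∀ (p : ℕ) [Fact p.Prime],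
      Nonempty ((ℤ_[p]ˣ ⧸ CommGroup.torsion ℤ_[p]ˣ) ≃* Multiplicative ℤ_[p])) ∧
    (∀ x : ℤ_[2]ˣ, x ∈ CommGroup.torsion ℤ_[2]ˣ ↔ x = 1 ∨ x = -1) := by
  refine ⟨fun p _ ↦ ?_, PadicInt.mem_torsion_units_two_iff⟩
  by_cases h : p = 2
  · subst h
    exact PadicInt.isExpBase_four.nonempty_quotient_torsion_mulEquiv
      PadicInt.exists_inv_mul_mem_torsion_two
  · exact (PadicInt.isExpBase_prime h).nonempty_quotient_torsion_mulEquiv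
      (PadicInt.exists_inv_mul_mem_torsion h)
end
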